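/- Let 0 < r₁ < r₂, let k ∈ ℤ and α ∈ ℝ satisfy α·ln(r₂/r₁) = kπ, and let K₁,K₂,K₃ ∈ ℝ satisfy K₁² + K₂² = 1 and K₃² = 1. Define d : ℝ² ∖ {0} → ℝ³ by d(x) = ( K₁·cos(α·ln(|x|/r₁)), K₂·cos(α·ln(|x|/r₁)), K₃·sin(α·ln(|x|/r₁)) ). Then on the open annulus {r₁ < |x| < r₂}: (i) |d(x)| = 1; (ii) |∇d(x)|² = α²/|x|²; (iii) Δd(x) + |∇d(x)|²·d(x) = 0. Moreover on each boundary circle |x| = r₁ and |x| = r₂ one has d₃(x) = 0 and the radial derivatives (x/|x|)·∇d₁(x) = 0 and (x/|x|)·∇d₂(x) = 0. -/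

import Mathlib

open scoped BigOperators

noncomputable section

abbrev E2 := EuclideanSpace ℝ (Fin 2)
abbrev E3 := EuclideanSpace ℝ (Fin 3)

/-- Partial derivative in the `i`-th coordinate direction of a scalar function on `ℝ²`. -/
noncomputable def pd (i : Fin 2) (f : E2 → ℝ) (x : E2) : ℝ :=
  fderiv ℝ f x (EuclideanSpace.single i 1)

/-- `|∇d|² = Σᵢⱼ (∂ᵢdⱼ)²` for a map `d : ℝ² → ℝ³`. -/
noncomputable def gradSq (d : E2 → E3) (x : E2) : ℝ :=
  ∑ i : Fin 2, ∑ j : Fin 3, (pd i (fun y => d y j) x) ^ 2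

/-- Componentwise Laplacian `Δf = ∂₁₁f + ∂₂₂f`. -/
noncomputable def lap (f : E2 → ℝ) (x : E2) : ℝ :=
  pd 0 (fun y => pd 0 f y) x + pd 1 (fun y => pd 1 f y) x

/-- The logarithm of the scaled norm has differential `⟪x, ·⟫ / ‖x‖²`. -/
theorem hasFDerivAt_log_norm_div {r : ℝ} (hr : r ≠ 0) {x : E2} (hx : x ≠ 0) :
    HasFDerivAt (fun y : E2 => Real.log (‖y‖ / r)) ((‖x‖ ^ 2)⁻¹ • innerSL ℝ x) x := by
  have hx2 : ‖x‖ ^ 2 ≠ 0 := by simpa using hx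
  have h := (((hasStrictFDerivAt_norm_sq x).hasFDerivAt.log hx2).const_mul (1 / 2 : ℝ)).sub_const
    (Real.log r)
  have hev : (fun y : E2 => Real.log (‖y‖ / r)) =ᶠ[nhds x]
      fun y => 1 / 2 * Real.log (‖y‖ ^ 2) - Real.log r := by
    filter_upwards [isOpen_ne.mem_nhds hx] with y hy
    rw [Real.log_div (norm_ne_zero_iff.mpr hy) hr, Real.log_pow]
    push_cast
    ring
  refine (h.congr_of_eventuallyEq hev).congr_fderiv ?_
  ext v
  simp
  ring

/-- Partial derivatives of a function of the logarithm of the norm. -/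
theorem pd_of_eq_comp_log_norm {r : ℝ} (hr : r ≠ 0) {f : E2 → ℝ} {g g' : ℝ → ℝ}
    (hf : ∀ y : E2, y ≠ 0 → f y = g (Real.log (‖y‖ / r)))
    (hg : ∀ t, HasDerivAt g (g' t) t) (i : Fin 2) {x : E2} (hx : x ≠ 0) :
    pd i f x = g' (Real.log (‖x‖ / r)) * (x i * (‖x‖ ^ 2)⁻¹) := by
  have hev : f =ᶠ[nhds x] fun y => g (Real.log (‖y‖ / r)) := by
    filter_upwards [isOpen_ne.mem_nhds hx] with y hy using hf y hy
  have h := ((hg _).comp_hasFDerivAt x (hasFDerivAt_log_norm_div hr hx)).congr_of_eventuallyEq hev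
  rw [pd, h.fderiv]
  simp [EuclideanSpace.inner_single_right]
  exact Or.inl (mul_comm _ _)

theorem norm_sq_eq_coord (x : E2) : ‖x‖ ^ 2 = x 0 ^ 2 + x 1 ^ 2 := by
  simp [EuclideanSpace.norm_sq_eq, Fin.sum_univ_two]

/-- Second partial derivatives of a function of the logarithm of the norm. -/
theorem pd_pd_of_eq_comp_log_norm {r : ℝ} (hr : r ≠ 0) {f : E2 → ℝ} {g g' g'' : ℝ → ℝ}
    (hf : ∀ y : E2, y ≠ 0 → f y = g (Real.log (‖y‖ / r)))
    (hg : ∀ t, HasDerivAt g (g' t) t) (hg' : ∀ t, HasDerivAt g' (g'' t) t)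
    (i : Fin 2) {x : E2} (hx : x ≠ 0) :
    pd i (fun y => pd i f y) x =
      g'' (Real.log (‖x‖ / r)) * (x i ^ 2 / ‖x‖ ^ 4) +
        g' (Real.log (‖x‖ / r)) * (1 / ‖x‖ ^ 2 - 2 * x i ^ 2 / ‖x‖ ^ 4) := by
  have hn : ‖x‖ ≠ 0 := norm_ne_zero_iff.mpr hx
  have hx2 : ‖x‖ ^ 2 ≠ 0 := pow_ne_zero 2 hn
  have hev : (fun y => pd i f y) =ᶠ[nhds x]
      fun y => g' (Real.log (‖y‖ / r)) * (y i * (‖y‖ ^ 2)⁻¹) := by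
    filter_upwards [isOpen_ne.mem_nhds hx] with y hy using pd_of_eq_comp_log_norm hr hf hg i hy
  have hinv := (hasDerivAt_inv hx2).comp_hasFDerivAt x (hasStrictFDerivAt_norm_sq x).hasFDerivAt
  have hcoord : HasFDerivAt (fun y : E2 => y i) (EuclideanSpace.proj i : E2 →L[ℝ] ℝ) x :=
    (EuclideanSpace.proj i : E2 →L[ℝ] ℝ).hasFDerivAt
  have h := (((hg' _).comp_hasFDerivAt x (hasFDerivAt_log_norm_div hr hx)).mul
    (hcoord.mul hinv)).congr_of_eventuallyEq hev
  rw [pd, h.fderiv]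
  simp [EuclideanSpace.inner_single_right]
  field_simp
  ring

/-- The planar Laplacian of a function of the logarithm of the norm. -/
theorem lap_of_eq_comp_log_norm {r : ℝ} (hr : r ≠ 0) {f : E2 → ℝ} {g g' g'' : ℝ → ℝ}
    (hf : ∀ y : E2, y ≠ 0 → f y = g (Real.log (‖y‖ / r)))
    (hg : ∀ t, HasDerivAt g (g' t) t) (hg' : ∀ t, HasDerivAt g' (g'' t) t)
    {x : E2} (hx : x ≠ 0) :
    lap f x = g'' (Real.log (‖x‖ / r)) / ‖x‖ ^ 2 := by
  have hn : ‖x‖ ≠ 0 := norm_ne_zero_iff.mpr hx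
  rw [lap, pd_pd_of_eq_comp_log_norm hr hf hg hg' 0 hx,
    pd_pd_of_eq_comp_log_norm hr hf hg hg' 1 hx]
  field_simp
  linear_combination (2 * g' (Real.log (‖x‖ / r)) - g'' (Real.log (‖x‖ / r))) * norm_sq_eq_coord x

theorem hasDerivAt_const_mul_cos (K α t : ℝ) :
    HasDerivAt (fun t => K * Real.cos (α * t)) (-(K * α) * Real.sin (α * t)) t := by
  refine ((((hasDerivAt_id t).const_mul α).cos).const_mul K).congr_deriv ?_
  simp
  ring

theorem hasDerivAt_const_mul_sin (K α t : ℝ) :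
    HasDerivAt (fun t => K * Real.sin (α * t)) (K * α * Real.cos (α * t)) t := by
  refine ((((hasDerivAt_id t).const_mul α).sin).const_mul K).congr_deriv ?_
  simp
  ring

/-- The explicit map
`d(x) = (K₁ cos(α ln(|x|/r₁)), K₂ cos(α ln(|x|/r₁)), K₃ sin(α ln(|x|/r₁)))`,
with `K₁² + K₂² = 1`, `K₃² = 1` and `α ln(r₂/r₁) = kπ`, is a unit-norm harmonic map
on the annulus `r₁ < |x| < r₂` with `|∇d|² = α²/|x|²`, and it satisfies the partially
free boundary conditions `d₃ = 0`, `(x/|x|)·∇d₁ = (x/|x|)·∇d₂ = 0` on both boundary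
circles. -/
theorem annulus_harmonic_map
    (r₁ r₂ α K₁ K₂ K₃ : ℝ) (k : ℤ)
    (hr₁ : 0 < r₁) (hr : r₁ < r₂)
    (hα : α * Real.log (r₂ / r₁) = k * Real.pi)
    (hK12 : K₁ ^ 2 + K₂ ^ 2 = 1) (hK3 : K₃ ^ 2 = 1)
    (d : E2 → E3)
    (hd : ∀ x : E2, x ≠ 0 →
      d x 0 = K₁ * Real.cos (α * Real.log (‖x‖ / r₁)) ∧
      d x 1 = K₂ * Real.cos (α * Real.log (‖x‖ / r₁)) ∧
      d x 2 = K₃ * Real.sin (α * Real.log (‖x‖ / r₁))) :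
    (∀ x : E2, r₁ < ‖x‖ → ‖x‖ < r₂ →
      ‖d x‖ = 1 ∧
      gradSq d x = α ^ 2 / ‖x‖ ^ 2 ∧
      (∀ j : Fin 3, lap (fun y => d y j) x + gradSq d x * d x j = 0)) ∧
    (∀ x : E2, (‖x‖ = r₁ ∨ ‖x‖ = r₂) →
      d x 2 = 0 ∧
      (∑ i : Fin 2, (x i / ‖x‖) * pd i (fun y => d y 0) x) = 0 ∧
      (∑ i : Fin 2, (x i / ‖x‖) * pd i (fun y => d y 1) x) = 0) := by
  have hr0 : r₁ ≠ 0 := hr₁.ne'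
  have h0 (y : E2) (hy : y ≠ 0) := (hd y hy).1
  have h1 (y : E2) (hy : y ≠ 0) := (hd y hy).2.1
  have h2 (y : E2) (hy : y ≠ 0) := (hd y hy).2.2
  have pd0 (i : Fin 2) {x : E2} (hx : x ≠ 0) := pd_of_eq_comp_log_norm hr0
    (f := fun y => d y 0) h0 (hasDerivAt_const_mul_cos K₁ α) i hx
  have pd1 (i : Fin 2) {x : E2} (hx : x ≠ 0) := pd_of_eq_comp_log_norm hr0
    (f := fun y => d y 1) h1 (hasDerivAt_const_mul_cos K₂ α) i hx
  have pd2 (i : Fin 2) {x : E2} (hx : x ≠ 0) := pd_of_eq_comp_log_norm hr0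
    (f := fun y => d y 2) h2 (hasDerivAt_const_mul_sin K₃ α) i hx
  constructor
  · intro x hx _
    have hn : 0 < ‖x‖ := hr₁.trans hx
    have hx0 : x ≠ 0 := norm_pos_iff.mp hn
    have hcs := Real.sin_sq_add_cos_sq (α * Real.log (‖x‖ / r₁))
    have hgrad : gradSq d x = α ^ 2 / ‖x‖ ^ 2 := by
      simp only [gradSq, Fin.sum_univ_two, Fin.sum_univ_three, pd0 _ hx0, pd1 _ hx0, pd2 _ hx0]
      set s := Real.sin (α * Real.log (‖x‖ / r₁))
      set c := Real.cos (α * Real.log (‖x‖ / r₁))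
      have hq := norm_sq_eq_coord x
      have hK : K₁ ^ 2 * s ^ 2 + K₂ ^ 2 * s ^ 2 + K₃ ^ 2 * c ^ 2 = 1 := by
        linear_combination s ^ 2 * hK12 + c ^ 2 * hK3 + hcs
      calc _ = α ^ 2 * (K₁ ^ 2 * s ^ 2 + K₂ ^ 2 * s ^ 2 + K₃ ^ 2 * c ^ 2) *
            (x 0 ^ 2 + x 1 ^ 2) * ((‖x‖ ^ 2)⁻¹) ^ 2 := by ring
        _ = α ^ 2 / ‖x‖ ^ 2 := by
          rw [hK, ← hq]
          field_simp
    refine ⟨?_, hgrad, ?_⟩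
    · rw [← sq_eq_sq₀ (norm_nonneg _) zero_le_one, EuclideanSpace.norm_sq_eq]
      simp only [Fin.sum_univ_three, Real.norm_eq_abs, sq_abs, h0 x hx0, h1 x hx0, h2 x hx0]
      linear_combination Real.cos (α * Real.log (‖x‖ / r₁)) ^ 2 * hK12 +
        Real.sin (α * Real.log (‖x‖ / r₁)) ^ 2 * hK3 + hcs
    · intro j
      rw [hgrad]
      fin_cases j
      · change lap (fun y => d y 0) x + _ * d x 0 = 0
        rw [lap_of_eq_comp_log_norm hr0 h0 (hasDerivAt_const_mul_cos K₁ α)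
          (hasDerivAt_const_mul_sin (-(K₁ * α)) α) hx0, h0 x hx0]
        ring
      · change lap (fun y => d y 1) x + _ * d x 1 = 0
        rw [lap_of_eq_comp_log_norm hr0 h1 (hasDerivAt_const_mul_cos K₂ α)
          (hasDerivAt_const_mul_sin (-(K₂ * α)) α) hx0, h1 x hx0]
        ring
      · change lap (fun y => d y 2) x + _ * d x 2 = 0
        rw [lap_of_eq_comp_log_norm hr0 h2 (hasDerivAt_const_mul_sin K₃ α)
          (hasDerivAt_const_mul_cos (K₃ * α) α) hx0, h2 x hx0]
        ring
  · intro x hx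
    have hx0 : x ≠ 0 := by
      rw [← norm_pos_iff]
      rcases hx with h | h <;> rw [h]
      exacts [hr₁, hr₁.trans hr]
    have hsin : Real.sin (α * Real.log (‖x‖ / r₁)) = 0 := by
      rcases hx with h | h <;> rw [h]
      · simp [hr0]
      · rw [hα, Real.sin_int_mul_pi]
    refine ⟨?_, ?_, ?_⟩
    · rw [h2 x hx0, hsin, mul_zero]
    · simp [pd0 _ hx0, hsin]
    · simp [pd1 _ hx0, hsin]

end
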